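/- Let n ≥ 1, let t ≥ 0 be an integer, and set η = 2^{−t}. Define C(η) = { x/‖x‖₂ : x ∈ ℝ^{n+1}, η^{−1}·x_i ∈ ℤ for all coordinates i, and ‖x‖_∞ = 1 } ⊆ S^n. Then: (1) for every z ∈ S^n there exists x ∈ C(η) with ρ(z, x) ≤ η·√n; and (2) C(η) is a finite set with cardinality at most 2(n+1)·(2^{t+1}+1)^n. -/

import Mathlib

open scoped RealInnerProductSpace


theorem aux_arccos (c d : ℝ) (hd : 0 ≤ d) (hc1 : -1 ≤ c) (hc2 : c ≤ 1)
    (h : 2 - 2 * c ≤ d ^ 2 / 4) : Real.arccos c ≤ d := by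
  have h0 := Real.arccos_nonneg c
  have h1 := Real.arccos_le_pi c
  have h2 := Real.cos_arccos hc1 hc2
  set θ := Real.arccos c
  have h3 : Real.cos θ ≤ 1 - 2 / Real.pi ^ 2 * θ ^ 2 :=
    Real.cos_le_one_sub_mul_cos_sq (by rw [abs_of_nonneg h0]; exact h1)
  have hp := Real.pi_pos
  have hp4 := Real.pi_le_four
  have h4 : 2 / Real.pi ^ 2 * θ ^ 2 ≤ d ^ 2 / 8 := by linarith
  have h5 : θ ^ 2 ≤ d ^ 2 / 16 * Real.pi ^ 2 := by
    have : 2 / Real.pi ^ 2 * θ ^ 2 * Real.pi ^ 2 ≤ d ^ 2 / 8 * Real.pi ^ 2 := by gcongr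
    have e : 2 / Real.pi ^ 2 * θ ^ 2 * Real.pi ^ 2 = 2 * θ ^ 2 := by field_simp
    linarith
  have h6 : Real.pi ^ 2 ≤ 16 := by nlinarith
  have h7 : θ ^ 2 ≤ d ^ 2 := by nlinarith [sq_nonneg d]
  exact (abs_le.1 (abs_le_of_sq_le_sq h7 hd)).2

theorem aux_inner {E : Type*} [NormedAddCommGroup E] [InnerProductSpace ℝ E] (w x : E)
    (hw : 1 ≤ ‖w‖) (hx : 1 ≤ ‖x‖) :
    2 - 2 * ⟪‖w‖⁻¹ • w, ‖x‖⁻¹ • x⟫ ≤ ‖w - x‖ ^ 2 := by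
  rw [inner_smul_left, inner_smul_right, norm_sub_sq_real]
  simp only [conj_trivial]
  have hw0 : 0 < ‖w‖ := by linarith
  have hx0 : 0 < ‖x‖ := by linarith
  have hi := real_inner_le_norm w x
  set I := ⟪w, x⟫
  have e : ‖w‖⁻¹ * (‖x‖⁻¹ * I) = I / (‖w‖ * ‖x‖) := by field_simp
  rw [e]
  have h1 : 1 ≤ ‖w‖ * ‖x‖ := one_le_mul_of_one_le_of_one_le hw hx
  set P := ‖w‖ * ‖x‖ with hP
  have h2 : 1 - I / P ≤ P - I := by
    have : 1 - I / P = (P - I) / P := by field_simp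
    rw [this]
    exact div_le_self (by linarith) h1
  nlinarith [sq_nonneg (‖w‖ - ‖x‖)]

theorem aux_one_le {n : ℕ} (x : EuclideanSpace ℝ (Fin (n + 1))) (i) (h : |x i| = 1) :
    1 ≤ ‖x‖ := by
  have := PiLp.norm_apply_le x i
  rwa [Real.norm_eq_abs, h] at this

/-- mesh on the sphere: for `η = 2^(-t)`, the set
`C(η) = { x/‖x‖ : η⁻¹·xᵢ ∈ ℤ for all i, ‖x‖_∞ = 1 } ⊆ S^n` satisfies:
(1) every `z ∈ S^n` is within angular distance `η·√n` of some point of `C(η)`; and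
(2) `C(η)` is finite of cardinality at most `2(n+1)·(2^(t+1)+1)^n`. -/
theorem stmt17 (n : ℕ) (hn : 1 ≤ n) (t : ℕ) (η : ℝ) (hη : η = (2 : ℝ) ^ (-(t : ℤ)))
    (C : Set (EuclideanSpace ℝ (Fin (n + 1))))
    (hC : C = {y | ∃ x : EuclideanSpace ℝ (Fin (n + 1)),
      (∀ i, ∃ m : ℤ, x i = η * m) ∧ (∀ i, |x i| ≤ 1) ∧ (∃ i, |x i| = 1) ∧
      y = ‖x‖⁻¹ • x}) :
    (∀ z : EuclideanSpace ℝ (Fin (n + 1)), ‖z‖ = 1 →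
      ∃ y ∈ C, Real.arccos ⟪z, y⟫ ≤ η * Real.sqrt n) ∧
    C.Finite ∧ Nat.card C ≤ 2 * (n + 1) * (2 ^ (t + 1) + 1) ^ n := by
  have hN : (0:ℝ) < 2 ^ t := by positivity
  have hηN : η * 2 ^ t = 1 := by
    rw [hη, zpow_neg, zpow_natCast]; field_simp
  have hη0 : 0 < η := by rw [hη]; positivity
  subst hC
  refine ⟨?_, ?_⟩
  · intro z hz
    obtain ⟨i0, hi0⟩ := Finite.exists_max (fun i => |z i|)
    have hM : 0 < |z i0| := by
      by_contra hcon
      have : z = 0 := by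
        ext i
        have := hi0 i
        have h2 := abs_nonneg (z i)
        exact abs_eq_zero.mp (by simp only at this; linarith)
      simp [this] at hz
    set M := |z i0| with hMdef
    set w : EuclideanSpace ℝ (Fin (n + 1)) := M⁻¹ • z with hw
    have hwi : ∀ i, w i = M⁻¹ * z i := fun i => by simp [hw]
    have hw1 : ∀ i, |w i| ≤ 1 := fun i => by
      rw [hwi, abs_mul, abs_of_pos (inv_pos.2 hM), inv_mul_le_iff₀ hM, mul_one]
      exact hi0 i
    have hw0 : |w i0| = 1 := by
      rw [hwi, abs_mul, abs_of_pos (inv_pos.2 hM), ← hMdef]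
      field_simp
    have hzw : z = ‖w‖⁻¹ • w := by
      rw [hw, norm_smul, hz, smul_smul, Real.norm_eq_abs, abs_of_pos (inv_pos.2 hM)]
      simp [hM.ne']
    set x : EuclideanSpace ℝ (Fin (n + 1)) :=
      WithLp.toLp 2 (fun i => η * (round (w i * 2 ^ t) : ℤ)) with hx
    have hxi : ∀ i, x i = η * (round (w i * 2 ^ t) : ℤ) := fun i => rfl
    have hdiff : ∀ i, |w i - x i| ≤ η / 2 := fun i => by
      have e : w i - x i = η * (w i * 2 ^ t - (round (w i * 2 ^ t) : ℤ)) := by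
        rw [hxi]; linear_combination (- w i) * hηN
      rw [e, abs_mul, abs_of_pos hη0]
      have := abs_sub_round (w i * 2 ^ t)
      nlinarith
    have hround : ∀ i, |((round (w i * 2 ^ t) : ℤ) : ℝ)| ≤ 2 ^ t := fun i => by
      have h1 := abs_le.1 (hw1 i)
      have h2 := abs_le.1 (abs_sub_round (w i * 2 ^ t))
      have hb1 : ((round (w i * 2 ^ t) : ℤ) : ℝ) < ((2 ^ t + 1 : ℤ) : ℝ) := by
        push_cast; nlinarith
      have hb2 : ((-(2 ^ t) - 1 : ℤ) : ℝ) < ((round (w i * 2 ^ t) : ℤ) : ℝ) := by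
        push_cast; nlinarith
      have hb1 := Int.cast_lt.1 hb1
      have hb2 := Int.cast_lt.1 hb2
      have : |round (w i * 2 ^ t)| ≤ 2 ^ t := abs_le.2 ⟨by linarith, by linarith⟩
      exact_mod_cast this
    have hx1 : ∀ i, |x i| ≤ 1 := fun i => by
      rw [hxi, abs_mul, abs_of_pos hη0, ← hηN]
      exact mul_le_mul_of_nonneg_left (hround i) hη0.le
    have hxw : x i0 = w i0 := by
      rw [hxi]
      rcases (abs_eq zero_le_one).1 hw0 with h | h
      · rw [h]
        have : (1:ℝ) * 2 ^ t = ((2 ^ t : ℤ) : ℝ) := by push_cast; ring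
        rw [this, round_intCast]; push_cast; exact hηN
      · rw [h]
        have : (-1:ℝ) * 2 ^ t = ((-2 ^ t : ℤ) : ℝ) := by push_cast; ring
        rw [this, round_intCast]; push_cast; linarith
    have hx0 : |x i0| = 1 := by rw [hxw, hw0]
    have hnw := aux_one_le w i0 hw0
    have hnx := aux_one_le x i0 hx0
    refine ⟨‖x‖⁻¹ • x, ⟨x, fun i => ⟨_, hxi i⟩, hx1, ⟨i0, hx0⟩, rfl⟩, ?_⟩
    have hny : ‖‖x‖⁻¹ • x‖ = 1 := by
      rw [norm_smul, norm_inv, norm_norm]; field_simp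
    have hab := abs_real_inner_le_norm z (‖x‖⁻¹ • x)
    rw [hz, hny, mul_one] at hab
    have hab := abs_le.1 hab
    have hin := aux_inner w x hnw hnx
    rw [← hzw] at hin
    refine aux_arccos _ _ (by positivity) hab.1 hab.2 (hin.trans ?_)
    rw [EuclideanSpace.norm_sq_eq, Fin.sum_univ_succAbove _ i0]
    have h0 : ‖(w - x) i0‖ ^ 2 = 0 := by simp [hxw]
    rw [h0, zero_add]
    have hs : ∑ j : Fin n, ‖(w - x) (i0.succAbove j)‖ ^ 2 ≤ ∑ j : Fin n, (η / 2) ^ 2 := by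
      refine Finset.sum_le_sum fun j _ => ?_
      have := hdiff (i0.succAbove j)
      rw [Real.norm_eq_abs]
      exact pow_le_pow_left₀ (abs_nonneg _) this 2
    refine hs.trans (le_of_eq ?_)
    rw [mul_pow, Real.sq_sqrt (Nat.cast_nonneg n)]
    simp
    ring
  · let v : Fin (n + 1) × Bool × (Fin n → Fin (2 ^ (t + 1) + 1)) →
        EuclideanSpace ℝ (Fin (n + 1)) := fun p =>
      WithLp.toLp 2 (p.1.insertNth (if p.2.1 then (1:ℝ) else -1)
        (fun j => η * (((p.2.2 j : ℕ) : ℝ) - 2 ^ t)) : Fin (n + 1) → ℝ)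
    let F := fun p => ‖v p‖⁻¹ • v p
    have hsub : {y | ∃ x : EuclideanSpace ℝ (Fin (n + 1)),
      (∀ i, ∃ m : ℤ, x i = η * m) ∧ (∀ i, |x i| ≤ 1) ∧ (∃ i, |x i| = 1) ∧
      y = ‖x‖⁻¹ • x} ⊆ Set.range F := by
      rintro y ⟨x, hxm, hx1, ⟨i, hi⟩, rfl⟩
      choose m hm using hxm
      have hmb : ∀ j, |m j| ≤ 2 ^ t := fun j => by
        have h := hx1 j
        rw [hm, abs_mul, abs_of_pos hη0, ← hηN] at h
        have := le_of_mul_le_mul_left h hη0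
        rw [← Int.cast_abs] at this
        apply (Int.cast_le (R := ℝ)).1
        push_cast at this ⊢
        exact this
      have hnn : ∀ j, 0 ≤ m j + 2 ^ t := fun j => by
        have := (abs_le.1 (hmb j)).1
        linarith
      have hlt : ∀ j, (m j + 2 ^ t).toNat < 2 ^ (t + 1) + 1 := fun j => by
        have := (abs_le.1 (hmb j)).2
        rw [Int.toNat_lt (hnn j)]
        push_cast
        rw [pow_succ]
        linarith
      refine ⟨(i, decide (x i = 1), fun j => ⟨_, hlt (i.succAbove j)⟩), ?_⟩
      have hv : v (i, decide (x i = 1), fun j => ⟨_, hlt (i.succAbove j)⟩) = x := by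
        ext k
        refine Fin.succAboveCases i ?_ (fun j => ?_) k
        · simp only [v, Fin.insertNth_apply_same]
          rcases (abs_eq zero_le_one).1 hi with h | h
          · simp [h]
          · rw [h]; norm_num
        · simp only [v, Fin.insertNth_apply_succAbove]
          rw [hm]
          have : (((m (i.succAbove j) + 2 ^ t).toNat : ℕ) : ℝ) = m (i.succAbove j) + 2 ^ t := by
            have := Int.toNat_of_nonneg (hnn (i.succAbove j))
            exact_mod_cast this
          rw [this]; ring
      simp only [F, hv]
    have hfin : (Set.range F).Finite := Set.finite_range F
    refine ⟨hfin.subset hsub, ?_⟩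
    refine (Nat.card_mono hfin hsub).trans ?_
    refine (Finite.card_range_le F).trans (le_of_eq ?_)
    simp [Nat.card_eq_fintype_card]
    ring
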